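/- Let d ≥ 3 be an integer and let G be a finite simple graph without isolated vertices and without universal vertices in which no two vertices are twins. If Θ_{d-2}(G) ≤ d, then G contains no induced copy of K_i^{+(d+1−i)} for any i with 4 ≤ i ≤ d, and no induced copy of K₃^{+(1,1,1)} ∪ K̄_{C(d−3,2)+1}. -/

import Mathlib

/-- The `p`-intersection number `Θ_p(G)`. -/
noncomputable def SimpleGraph.pIntersectionNumber {V : Type*} (G : SimpleGraph V)
    (p : ℕ) : ℕ :=
  sInf {d : ℕ | ∃ S : V → Finset (Fin d),
    ∀ u v : V, u ≠ v → (G.Adj u v ↔ p ≤ (S u ∩ S v).card)}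

/-- Two vertices are twins if they have the same open neighborhood or the same
closed neighborhood. -/
def SimpleGraph.IsTwinPair {V : Type*} (G : SimpleGraph V) (u v : V) : Prop :=
  G.neighborSet u = G.neighborSet v ∨
    insert u (G.neighborSet u) = insert v (G.neighborSet v)

/-- `K_{r'+1}^{+(s)}`: a clique on the vertex `inl ()` and the `r'` vertices
`inr (inl i)`, with `s` pendant vertices attached to `inl ()`. -/
def Kplus (r' s : ℕ) : SimpleGraph (Unit ⊕ (Fin r' ⊕ Fin s)) :=
  SimpleGraph.fromRel (fun a b =>
    match a, b with
    | Sum.inl _, _ => True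
    | _, Sum.inl _ => True
    | Sum.inr (Sum.inl _), Sum.inr (Sum.inl _) => True
    | _, _ => False)

/-- `K₃^{+(1,1,1)}`: a triangle with one pendant vertex attached to each of its
three vertices. -/
def K3p111 : SimpleGraph (Fin 3 ⊕ Fin 3) :=
  SimpleGraph.fromRel (fun a b =>
    match a, b with
    | Sum.inl _, Sum.inl _ => True
    | Sum.inl i, Sum.inr j => (i : ℕ) = (j : ℕ)
    | _, _ => False)

/-- `G` contains `F` as an induced subgraph. -/
def SimpleGraph.HasInducedCopy {α β : Type*} (F : SimpleGraph α)
    (G : SimpleGraph β) : Prop :=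
  Nonempty (F ↪g G)

open Finset

namespace SimpleGraph

variable {V : Type*} {G : SimpleGraph V}

/-- Every finite graph has a `p`-intersection representation when `p` is positive. -/
theorem exists_pIntersection_representation [Fintype V] (G : SimpleGraph V) {p : ℕ}
    (hp : 1 ≤ p) : ∃ (d : ℕ) (S : V → Finset (Fin d)),
      ∀ u v : V, u ≠ v → (G.Adj u v ↔ p ≤ (S u ∩ S v).card) := by
  classical
  let e := Fintype.equivFin (Fin (p - 1) ⊕ Sym2 V)
  refine ⟨_, fun u => ((univ : Finset (Fin (p - 1))).disjSum
    {x : Sym2 V | x ∈ G.edgeSet ∧ u ∈ x}).map e.toEmbedding, fun u v huv => ?_⟩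
  have hinter : ((univ : Finset (Fin (p - 1))).disjSum {x : Sym2 V | x ∈ G.edgeSet ∧ u ∈ x}) ∩
      ((univ : Finset (Fin (p - 1))).disjSum {x : Sym2 V | x ∈ G.edgeSet ∧ v ∈ x}) =
      (univ : Finset (Fin (p - 1))).disjSum
        {x : Sym2 V | x ∈ G.edgeSet ∧ x = s(u, v)} := by
    ext (x | x)
    · simp
    · simp only [mem_inter, inr_mem_disjSum, mem_filter, mem_univ, true_and,
        ← Sym2.mem_and_mem_iff huv]
      tauto
  rw [← map_inter, card_map, hinter, card_disjSum, card_univ, Fintype.card_fin]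
  by_cases h : G.Adj u v
  · have : ({x : Sym2 V | x ∈ G.edgeSet ∧ x = s(u, v)} : Finset (Sym2 V)) = {s(u, v)} := by
      ext x
      simp only [mem_filter, mem_univ, true_and, mem_singleton, and_iff_right_iff_imp]
      rintro rfl
      exact h
    rw [this, card_singleton]
    simp only [h, true_iff]
    omega
  · have : ({x : Sym2 V | x ∈ G.edgeSet ∧ x = s(u, v)} : Finset (Sym2 V)) = ∅ := by
      ext x
      simp only [mem_filter, mem_univ, true_and, notMem_empty, iff_false, not_and]
      rintro hx rfl
      exact h hx
    rw [this, card_empty]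
    simp only [h, false_iff]
    omega

/-- A bound on the `p`-intersection number yields a representation of that size. -/
theorem exists_representation_of_pIntersectionNumber_le [Fintype V] {p d : ℕ} (hp : 1 ≤ p)
    (h : G.pIntersectionNumber p ≤ d) : ∃ S : V → Finset (Fin d),
      ∀ u v : V, u ≠ v → (G.Adj u v ↔ p ≤ (S u ∩ S v).card) := by
  unfold pIntersectionNumber at h
  obtain ⟨S, hS⟩ := Nat.sInf_mem (s := {d : ℕ | ∃ S : V → Finset (Fin d),
    ∀ u v : V, u ≠ v → (G.Adj u v ↔ p ≤ (S u ∩ S v).card)})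
    (G.exists_pIntersection_representation hp)
  refine ⟨fun u => (S u).map (Fin.castLEEmb h), fun u v huv => ?_⟩
  rw [← map_inter, card_map]
  exact hS u v huv

/-- A representation of `G` by the complements of the sets of a `(d - 2)`-intersection
representation on `d` elements: distinct sets of size one or two, with adjacency meaning that
the union has at most two elements. -/
structure IsSmallUnionRepresentation {α : Type*} [DecidableEq α] (G : SimpleGraph V)
    (T : V → Finset α) : Prop where
  injective : Function.Injective T
  one_le_card : ∀ v, 1 ≤ (T v).card
  card_le_two : ∀ v, (T v).card ≤ 2
  adj_iff : ∀ u v, u ≠ v → (G.Adj u v ↔ (T u ∪ T v).card ≤ 2)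

theorem exists_isSmallUnionRepresentation [Fintype V] {d : ℕ} (hd : 3 ≤ d)
    (hiso : ∀ v : V, ∃ w : V, G.Adj v w)
    (huniv : ∀ v : V, ∃ w : V, w ≠ v ∧ ¬ G.Adj v w)
    (htwin : ∀ u v : V, u ≠ v → ¬ G.IsTwinPair u v)
    (hθ : G.pIntersectionNumber (d - 2) ≤ d) :
    ∃ T : V → Finset (Fin d), G.IsSmallUnionRepresentation T := by
  obtain ⟨S, hS⟩ := exists_representation_of_pIntersectionNumber_le (by omega) hθ
  have hadj : ∀ u v, u ≠ v → (G.Adj u v ↔ ((S u)ᶜ ∪ (S v)ᶜ).card ≤ 2) := by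
    intro u v huv
    rw [hS u v huv, ← compl_inter, card_compl, Fintype.card_fin]
    omega
  have htwo : ∀ v, ((S v)ᶜ).card ≤ 2 := by
    intro v
    obtain ⟨w, hw⟩ := hiso v
    exact (card_le_card subset_union_left).trans ((hadj v w hw.ne).1 hw)
  refine ⟨fun v => (S v)ᶜ, ?_, ?_, htwo, hadj⟩
  · intro u v huv
    by_contra hne
    refine htwin u v hne (Or.inr ?_)
    have huv' : (S u)ᶜ = (S v)ᶜ := huv
    have huvadj : G.Adj u v := by
      rw [hadj u v hne, huv', union_self]
      exact htwo v
    ext w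
    simp only [Set.mem_insert_iff, mem_neighborSet]
    by_cases hwu : w = u
    · subst hwu
      simp [huvadj.symm]
    · by_cases hwv : w = v
      · subst hwv
        simp [huvadj]
      · rw [hadj u w (Ne.symm hwu), hadj v w (Ne.symm hwv), huv']
        simp [hwu, hwv]
  · intro v
    by_contra h
    have h0 : (S v)ᶜ = ∅ := by
      rw [← card_eq_zero]
      simpa using h
    obtain ⟨w, hne, hw⟩ := huniv v
    apply hw
    rw [hadj v w hne.symm, h0, empty_union]
    exact htwo w

namespace IsSmallUnionRepresentation

variable {α : Type*} [DecidableEq α] {T : V → Finset α}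

theorem subset_of_adj (hT : G.IsSmallUnionRepresentation T) {u v : V} (hu : (T u).card = 2)
    (h : G.Adj u v) : T v ⊆ T u := by
  have h2 := (hT.adj_iff u v h.ne).1 h
  rw [eq_of_subset_of_card_le (subset_union_left (s₁ := T u) (s₂ := T v)) (by omega)]
  exact subset_union_right

/-- A vertex represented by a pair has at most two neighbors. -/
theorem exists_eq_singleton (hT : G.IsSmallUnionRepresentation T) {u v₁ v₂ v₃ : V}
    (h₁ : G.Adj u v₁) (h₂ : G.Adj u v₂) (h₃ : G.Adj u v₃)
    (h₁₂ : v₁ ≠ v₂) (h₁₃ : v₁ ≠ v₃) (h₂₃ : v₂ ≠ v₃) : ∃ a, T u = {a} := by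
  rw [← card_eq_one]
  by_contra hne
  have hu : (T u).card = 2 := by
    have := hT.one_le_card u
    have := hT.card_le_two u
    omega
  have key : ∀ v, G.Adj u v → ∃ a ∈ T u, T v = {a} := by
    intro v hv
    have hsub := hT.subset_of_adj hu hv
    have hlt : (T v).card < (T u).card :=
      card_lt_card (hsub.ssubset_of_ne fun h => hv.ne (hT.injective h.symm))
    obtain ⟨a, ha⟩ := card_eq_one.1 (show (T v).card = 1 by
      have := hT.one_le_card v
      omega)
    exact ⟨a, hsub (by simp [ha]), ha⟩
  obtain ⟨a₁, ha₁, e₁⟩ := key v₁ h₁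
  obtain ⟨a₂, ha₂, e₂⟩ := key v₂ h₂
  obtain ⟨a₃, ha₃, e₃⟩ := key v₃ h₃
  have ne_of {v w : V} {a b : α} (hv : T v = {a}) (hw : T w = {b}) (h : v ≠ w) : a ≠ b := by
    rintro rfl
    exact h (hT.injective (hv.trans hw.symm))
  have hcard : ({a₁, a₂, a₃} : Finset α).card = 3 :=
    card_eq_three.2 ⟨a₁, a₂, a₃, ne_of e₁ e₂ h₁₂, ne_of e₁ e₃ h₁₃, ne_of e₂ e₃ h₂₃, rfl⟩
  have hle : ({a₁, a₂, a₃} : Finset α).card ≤ (T u).card :=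
    card_le_card (by simp [insert_subset_iff, ha₁, ha₂, ha₃])
  omega

/-- A vertex not adjacent to one represented by `{a}` is represented by a pair avoiding `a`. -/
theorem of_not_adj_singleton (hT : G.IsSmallUnionRepresentation T) {u v : V} {a : α}
    (hu : T u = {a}) (hne : u ≠ v) (h : ¬ G.Adj u v) : (T v).card = 2 ∧ a ∉ T v := by
  rw [hT.adj_iff u v hne, hu, singleton_union] at h
  have h2 := hT.card_le_two v
  refine ⟨?_, fun ha => h (by rwa [insert_eq_of_mem ha])⟩
  have := card_insert_le a (T v)
  omega

theorem not_hasInducedCopy_Kplus [Fintype α] (hT : G.IsSmallUnionRepresentation T) {r s : ℕ}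
    (hr : 3 ≤ r) (h : Fintype.card α ≤ r + s) : ¬ HasInducedCopy (Kplus r s) G := by
  rintro ⟨f⟩
  have hclique : ∀ j, G.Adj (f (.inl ())) (f (.inr (.inl j))) := by
    intro j
    rw [f.map_adj_iff]
    simp [Kplus]
  have hclique' : ∀ j k, j ≠ k → G.Adj (f (.inr (.inl j))) (f (.inr (.inl k))) := by
    intro j k hjk
    rw [f.map_adj_iff]
    simp [Kplus, hjk]
  have hpendant : ∀ k, G.Adj (f (.inl ())) (f (.inr (.inr k))) := by
    intro k
    rw [f.map_adj_iff]
    simp [Kplus]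
  have hnot : ∀ j k, ¬ G.Adj (f (.inr (.inl j))) (f (.inr (.inr k))) := by
    intro j k
    rw [f.map_adj_iff]
    simp [Kplus]
  have hf : ∀ {x y}, x ≠ y → f x ≠ f y := fun hxy => f.injective.ne hxy
  obtain ⟨c, hc⟩ : ∃ c, T (f (.inl ())) = {c} :=
    hT.exists_eq_singleton (hclique ⟨0, by omega⟩) (hclique ⟨1, by omega⟩)
      (hclique ⟨2, by omega⟩) (hf (by simp)) (hf (by simp)) (hf (by simp))
  have hsingle : ∀ j, ∃ a, T (f (.inr (.inl j))) = {a} := by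
    intro j
    obtain ⟨k, l, hk, hl, hkl⟩ : ∃ k l : Fin r, k ≠ j ∧ l ≠ j ∧ k ≠ l := by
      have hcard : 1 < (univ.erase j).card := by
        rw [card_erase_of_mem (mem_univ j), card_univ, Fintype.card_fin]
        omega
      obtain ⟨k, hk, l, hl, hkl⟩ := one_lt_card.1 hcard
      exact ⟨k, l, ne_of_mem_erase hk, ne_of_mem_erase hl, hkl⟩
    exact hT.exists_eq_singleton (hclique j).symm (hclique' j k hk.symm) (hclique' j l hl.symm)
      (hf (by simp)) (hf (by simp)) (hf (by simpa using hkl))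
  choose a ha using hsingle
  have hpair : ∀ k, ∃ x, x ≠ c ∧ T (f (.inr (.inr k))) = {c, x} := by
    intro k
    have h2 := (hT.of_not_adj_singleton (ha ⟨0, by omega⟩) (hf (by simp)) (hnot _ k)).1
    have hsub := hT.subset_of_adj h2 (hpendant k).symm
    rw [hc, singleton_subset_iff] at hsub
    obtain ⟨x, hx⟩ := card_eq_one.1 (show ((T (f (.inr (.inr k)))).erase c).card = 1 by
      rw [card_erase_of_mem hsub, h2])
    refine ⟨x, ne_of_mem_erase (hx ▸ mem_singleton_self x), ?_⟩
    rw [← insert_erase hsub, hx]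
  choose x hxc hx using hpair
  have hac : ∀ j, a j ≠ c := fun j hj => (hclique j).ne (hT.injective (by rw [hc, ha, hj]))
  have hax : ∀ j k, a j ≠ x k := fun j k hjk =>
    (hT.of_not_adj_singleton (ha j) (hf (by simp)) (hnot j k)).2 (by simp [hx, hjk])
  have hainj : Function.Injective a := fun j k hjk => by
    have := f.injective (hT.injective ((ha j).trans (hjk ▸ (ha k).symm)))
    simpa using this
  have hxinj : Function.Injective x := fun j k hjk => by
    have := f.injective (hT.injective ((hx j).trans (hjk ▸ (hx k).symm)))
    simpa using this
  have hinj : Function.Injective (Sum.elim (fun _ : Unit => c) (Sum.elim a x)) :=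
    Function.Injective.sumElim (fun _ _ _ => rfl) (hainj.sumElim hxinj hax) (by
      rintro _ (j | k)
      · exact (hac j).symm
      · exact (hxc k).symm)
  have hcard := Fintype.card_le_of_injective _ hinj
  simp only [Fintype.card_sum, Fintype.card_unit, Fintype.card_fin] at hcard
  omega

theorem not_hasInducedCopy_K3p111_sum [Fintype α] (hT : G.IsSmallUnionRepresentation T) {n : ℕ}
    (h : (Fintype.card α - 3).choose 2 < n) :
    ¬ HasInducedCopy (K3p111 ⊕g (⊥ : SimpleGraph (Fin n))) G := by
  rintro ⟨f⟩
  have hf : ∀ {x y}, x ≠ y → f x ≠ f y := fun hxy => f.injective.ne hxy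
  have htri : ∀ i j, i ≠ j → G.Adj (f (.inl (.inl i))) (f (.inl (.inl j))) := by
    intro i j hij
    rw [f.map_adj_iff]
    simp [K3p111, hij]
  have hpendant : ∀ i, G.Adj (f (.inl (.inl i))) (f (.inl (.inr i))) := by
    intro i
    rw [f.map_adj_iff]
    simp [K3p111]
  have hnot : ∀ i k, ¬ G.Adj (f (.inl (.inl i))) (f (.inr k)) := by
    intro i k
    rw [f.map_adj_iff]
    simp
  have hsingle : ∀ i, ∃ a, T (f (.inl (.inl i))) = {a} := by
    intro i
    obtain ⟨j, k, hj, hk, hjk⟩ : ∃ j k : Fin 3, i ≠ j ∧ i ≠ k ∧ j ≠ k := by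
      revert i
      decide
    exact hT.exists_eq_singleton (htri i j hj) (htri i k hk) (hpendant i)
      (hf (by simpa using hjk)) (hf (by simp)) (hf (by simp))
  choose a ha using hsingle
  have hainj : Function.Injective a := fun i j hij => by
    have := f.injective (hT.injective ((ha i).trans (hij ▸ (ha j).symm)))
    simpa using this
  have hmem : ∀ k, T (f (.inr k)) ∈ powersetCard 2 (univ.image a)ᶜ := by
    intro k
    have hk := fun i => hT.of_not_adj_singleton (ha i) (hf (by simp)) (hnot i k)
    refine mem_powersetCard.2 ⟨fun y hy => ?_, (hk 0).1⟩
    simp only [mem_compl, mem_image, mem_univ, true_and, not_exists]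
    rintro i rfl
    exact (hk i).2 hy
  have hcard := card_le_card_of_injOn (s := univ) (fun k => T (f (.inr k)))
    (fun k _ => hmem k) (fun k _ l _ hkl => by
      have := f.injective (hT.injective hkl)
      simpa using this)
  rw [card_powersetCard, card_compl, card_image_of_injective _ hainj, card_univ, card_univ,
    Fintype.card_fin, Fintype.card_fin] at hcard
  omega

end IsSmallUnionRepresentation

end SimpleGraph

/-- For an integer `d ≥ 3` and a finite twin-free graph `G` without isolated or
universal vertices, if `Θ_{d-2}(G) ≤ d` then `G` contains no induced copy of
`K_i^{+(d+1−i)}` for `4 ≤ i ≤ d`, and no induced copy of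
`K₃^{+(1,1,1)} ∪ K̄_{C(d−3,2)+1}`. -/
theorem forb_Kplus_and_K3p111 {V : Type*} [Fintype V]
    (d : ℕ) (hd : 3 ≤ d) (G : SimpleGraph V)
    (hiso : ∀ v : V, ∃ w : V, G.Adj v w)
    (huniv : ∀ v : V, ∃ w : V, w ≠ v ∧ ¬ G.Adj v w)
    (htwin : ∀ u v : V, u ≠ v → ¬ G.IsTwinPair u v)
    (hθ : G.pIntersectionNumber (d - 2) ≤ d) :
    (∀ i : ℕ, 4 ≤ i → i ≤ d →
      ¬ SimpleGraph.HasInducedCopy (Kplus (i - 1) (d + 1 - i)) G) ∧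
    ¬ SimpleGraph.HasInducedCopy
        (K3p111 ⊕g (⊥ : SimpleGraph (Fin ((d - 3).choose 2 + 1)))) G := by
  obtain ⟨T, hT⟩ := SimpleGraph.exists_isSmallUnionRepresentation hd hiso huniv htwin hθ
  refine ⟨fun i hi hid => hT.not_hasInducedCopy_Kplus (by omega) ?_,
    hT.not_hasInducedCopy_K3p111_sum ?_⟩
  · rw [Fintype.card_fin]
    omega
  · rw [Fintype.card_fin]
    exact Nat.lt_succ_self _
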